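/- Let t < T be real numbers, Δ = T − t, and let {φ_j} be the shifted Legendre system on [t, T]. For j₁, j₂, j₃ ∈ ℕ define C_{j₃j₂j₁} = ∫_t^T φ_{j₃}(z) ∫_t^z φ_{j₂}(y) ∫_t^y φ_{j₁}(x) dx dy dz. Then lim_{q→∞} Σ_{j₂=0}^∞ (Σ_{j₁=0}^{q} C_{j₁j₂j₁})² = 0; in particular, for every j₂ ∈ ℕ, Σ_{j₁=0}^∞ C_{j₁j₂j₁} = 0. -/

import Mathlib

/-- The Legendre polynomial via the Rodrigues formula. -/
noncomputable def legendreP (n : ℕ) (x : ℝ) : ℝ :=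
  (1 / (2 ^ n * (Nat.factorial n : ℝ))) *
    iteratedDeriv n (fun y : ℝ => (y ^ 2 - 1) ^ n) x

/-- The shifted Legendre system on `[t, T]`. -/
noncomputable def shiftedLegendre (t T : ℝ) (j : ℕ) (x : ℝ) : ℝ :=
  Real.sqrt ((2 * (j : ℝ) + 1) / (T - t)) *
    legendreP j ((x - t - (T - t) / 2) * (2 / (T - t)))

/-- Triple Fourier–Legendre coefficient
`C_{j₃j₂j₁} = ∫_t^T φ_{j₃}(z) ∫_t^z φ_{j₂}(y) ∫_t^y φ_{j₁}(x) dx dy dz`. -/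
noncomputable def tripleCoeff (t T : ℝ) (j₃ j₂ j₁ : ℕ) : ℝ :=
  ∫ z in t..T, shiftedLegendre t T j₃ z *
    ∫ y in t..z, shiftedLegendre t T j₂ y *
      ∫ x in t..y, shiftedLegendre t T j₁ x

open scoped Polynomial

namespace Polynomial

/-- Repeated integration by parts for polynomials: the boundary terms vanish when `p` has zeros of
order `n` at both end points. -/
theorem integral_iterate_derivative_mul (a b : ℝ) (n : ℕ) (p q : ℝ[X])
    (ha : ∀ k < n, (derivative^[k] p).eval a = 0) (hb : ∀ k < n, (derivative^[k] p).eval b = 0) :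
    ∫ x in a..b, (derivative^[n] p).eval x * q.eval x =
      (-1) ^ n * ∫ x in a..b, p.eval x * (derivative^[n] q).eval x := by
  induction n generalizing q with
  | zero => simp
  | succ n ih =>
    have ih := ih (derivative q) (fun k hk => ha k (by lia)) (fun k hk => hb k (by lia))
    have parts := intervalIntegral.integral_mul_deriv_eq_deriv_mul (a := a) (b := b)
      (u := fun x => (derivative^[n] p).eval x) (v := fun x => q.eval x)
      (u' := fun x => (derivative (derivative^[n] p)).eval x)
      (v' := fun x => (derivative q).eval x)
      (fun x _ => Polynomial.hasDerivAt _ x) (fun x _ => Polynomial.hasDerivAt _ x)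
      ((Polynomial.continuous _).intervalIntegrable _ _)
      ((Polynomial.continuous _).intervalIntegrable _ _)
    rw [ha n (by lia), hb n (by lia)] at parts
    rw [Function.iterate_succ_apply', Function.iterate_succ_apply, pow_succ]
    linarith

/-- The polynomial whose evaluation is `legendreP n`. -/
noncomputable def rodrigues (n : ℕ) : ℝ[X] :=
  C (1 / (2 ^ n * (n.factorial : ℝ))) * derivative^[n] ((X ^ 2 - 1) ^ n)

theorem iteratedDeriv_eval (p : ℝ[X]) (n : ℕ) :
    iteratedDeriv n (fun x => p.eval x) = fun x => (derivative^[n] p).eval x := by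
  induction n with
  | zero => simp
  | succ n ih =>
    ext x
    rw [iteratedDeriv_succ, ih, Polynomial.deriv, Function.iterate_succ_apply']

theorem legendreP_eq_eval (n : ℕ) (x : ℝ) : legendreP n x = (rodrigues n).eval x := by
  have := congrFun (iteratedDeriv_eval ((X ^ 2 - 1) ^ n) n) x
  simp only [eval_pow, eval_sub, eval_X, eval_one] at this
  rw [legendreP, rodrigues, this, eval_mul, eval_C]

theorem eval_iterate_derivative_sq_sub_one_pow {n k : ℕ} (hk : k < n) {a : ℝ} (ha : a ^ 2 = 1) :
    (derivative^[k] ((X ^ 2 - 1) ^ n : ℝ[X])).eval a = 0 := by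
  obtain ⟨r, hr⟩ := pow_sub_dvd_iterate_derivative_pow (X ^ 2 - 1 : ℝ[X]) n k
  simp [hr, ha, Nat.sub_ne_zero_of_lt hk]

theorem monic_sq_sub_one : (X ^ 2 - 1 : ℝ[X]).Monic := by
  simpa using monic_X_pow_sub_C (1 : ℝ) two_ne_zero

theorem natDegree_sq_sub_one_pow (n : ℕ) : ((X ^ 2 - 1 : ℝ[X]) ^ n).natDegree = 2 * n := by
  have : (X ^ 2 - 1 : ℝ[X]).natDegree = 2 := by simpa using natDegree_X_pow_sub_C (r := (1 : ℝ))
  rw [natDegree_pow, this, mul_comm]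

theorem natDegree_rodrigues_le (n : ℕ) : (rodrigues n).natDegree ≤ n := by
  refine (natDegree_C_mul_le _ _).trans ((natDegree_iterate_derivative _ _).trans ?_)
  rw [natDegree_sq_sub_one_pow]
  lia

theorem coeff_rodrigues_self (n : ℕ) :
    (rodrigues n).coeff n = (2 * n).factorial / (2 ^ n * (n.factorial : ℝ) ^ 2) := by
  have hc : ((X ^ 2 - 1 : ℝ[X]) ^ n).coeff (n + n) = 1 := by
    have h := (monic_sq_sub_one.pow n).coeff_natDegree
    rwa [natDegree_sq_sub_one_pow, two_mul] at h
  have hd : ((n.factorial : ℝ)) * ((n + n).descFactorial n : ℝ) = (2 * n).factorial := by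
    have := Nat.factorial_mul_descFactorial (n := n + n) (k := n) (by lia)
    rw [Nat.add_sub_cancel] at this
    rw [two_mul]
    exact_mod_cast this
  have hn : (n.factorial : ℝ) ≠ 0 := by positivity
  rw [rodrigues, coeff_C_mul, coeff_iterate_derivative, hc, ← hd, nsmul_eq_mul]
  field_simp

theorem degree_rodrigues (n : ℕ) : (rodrigues n).degree = n :=
  degree_eq_of_le_of_coeff_ne_zero (natDegree_le_iff_degree_le.mp (natDegree_rodrigues_le n))
    (by rw [coeff_rodrigues_self]; positivity)

theorem integral_sq_sub_one_pow (n : ℕ) :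
    ∫ x in (-1 : ℝ)..1, (x ^ 2 - 1) ^ n =
      (-1) ^ n * 2 ^ (2 * n + 1) * (n.factorial : ℝ) ^ 2 / (2 * n + 1).factorial := by
  induction n with
  | zero => norm_num
  | succ n ih =>
    have hder (x : ℝ) : HasDerivAt (fun x : ℝ => x * (x ^ 2 - 1) ^ (n + 1))
        ((2 * n + 3) * (x ^ 2 - 1) ^ (n + 1) + (2 * n + 2) * (x ^ 2 - 1) ^ n) x := by
      have h := (hasDerivAt_id' x).mul ((((hasDerivAt_pow 2 x).sub_const 1)).pow (n + 1))
      convert! h using 1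
      simp only [Pi.pow_apply]
      push_cast
      ring
    have hftc := intervalIntegral.integral_eq_sub_of_hasDerivAt (a := -1) (b := 1)
      (fun x _ => hder x) (Continuous.intervalIntegrable (by fun_prop) _ _)
    rw [intervalIntegral.integral_add (Continuous.intervalIntegrable (by fun_prop) _ _)
      (Continuous.intervalIntegrable (by fun_prop) _ _), intervalIntegral.integral_const_mul,
      intervalIntegral.integral_const_mul, ih] at hftc
    have h3 : (2 * n + 3 : ℝ) ≠ 0 := by positivity
    have hF : ((2 * n + 1).factorial : ℝ) ≠ 0 := by positivity
    have e : 2 * (n + 1) + 1 = (2 * n + 1) + 1 + 1 := by ring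
    rw [e, Nat.factorial_succ (2 * n + 1 + 1), Nat.factorial_succ (2 * n + 1), Nat.factorial_succ n]
    push_cast
    have : (2 * n + 3 : ℝ) * ∫ x in (-1 : ℝ)..1, (x ^ 2 - 1) ^ (n + 1) = -((2 * n + 2) *
        ((-1) ^ n * 2 ^ (2 * n + 1) * (n.factorial : ℝ) ^ 2 / (2 * n + 1).factorial)) := by
      norm_num at hftc
      linarith
    rw [eq_comm, ← mul_right_inj' h3, this]
    field_simp
    ring

theorem integral_rodrigues_mul (n : ℕ) (q : ℝ[X]) :
    ∫ x in (-1 : ℝ)..1, (rodrigues n).eval x * q.eval x =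
      1 / (2 ^ n * (n.factorial : ℝ)) *
        ((-1) ^ n * ∫ x in (-1 : ℝ)..1, (x ^ 2 - 1) ^ n * (derivative^[n] q).eval x) := by
  have h := integral_iterate_derivative_mul (-1) 1 n ((X ^ 2 - 1) ^ n) q
    (fun k hk => eval_iterate_derivative_sq_sub_one_pow hk (by norm_num))
    (fun k hk => eval_iterate_derivative_sq_sub_one_pow hk (by norm_num))
  simp only [eval_pow, eval_sub, eval_X, eval_one] at h
  rw [← h, ← intervalIntegral.integral_const_mul]
  simp only [rodrigues, eval_mul, eval_C, mul_assoc]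

theorem integral_rodrigues_mul_of_lt {m n : ℕ} (hmn : m < n) :
    ∫ x in (-1 : ℝ)..1, (rodrigues n).eval x * (rodrigues m).eval x = 0 := by
  simp [integral_rodrigues_mul,
    iterate_derivative_eq_zero ((natDegree_rodrigues_le m).trans_lt hmn)]

theorem integral_rodrigues_sq (n : ℕ) :
    ∫ x in (-1 : ℝ)..1, (rodrigues n).eval x * (rodrigues n).eval x = 2 / (2 * n + 1) := by
  have hconst : derivative^[n] (rodrigues n) =
      C (((2 * n).factorial : ℝ) / (2 ^ n * n.factorial)) := by
    have hdeg : (derivative^[n] (rodrigues n)).natDegree = 0 := by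
      have := natDegree_iterate_derivative (rodrigues n) n
      have := natDegree_rodrigues_le n
      lia
    rw [eq_C_of_natDegree_eq_zero hdeg, coeff_iterate_derivative, zero_add, coeff_rodrigues_self,
      Nat.descFactorial_self, nsmul_eq_mul]
    congr 1
    field_simp
  rw [integral_rodrigues_mul, hconst]
  simp only [eval_C]
  rw [intervalIntegral.integral_mul_const, integral_sq_sub_one_pow, Nat.factorial_succ]
  push_cast
  have hsq : ((-1 : ℝ) ^ n) ^ 2 = 1 := by rw [← pow_mul, mul_comm, pow_mul]; norm_num
  field_simp
  rw [hsq]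
  ring

theorem integral_rodrigues_mul_rodrigues (m n : ℕ) :
    ∫ x in (-1 : ℝ)..1, (rodrigues m).eval x * (rodrigues n).eval x =
      if m = n then 2 / (2 * (n : ℝ) + 1) else 0 := by
  rcases lt_trichotomy m n with h | rfl | h
  · simp_rw [mul_comm ((rodrigues m).eval _)]
    rw [integral_rodrigues_mul_of_lt h, if_neg h.ne]
  · rw [integral_rodrigues_sq, if_pos rfl]
  · rw [integral_rodrigues_mul_of_lt h, if_neg h.ne']

end Polynomial

section

open MeasureTheory
open Polynomial hiding shiftedLegendre

/-- The shifted Legendre system as a polynomial sequence. -/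
noncomputable def shiftedLegendreSequence {t T : ℝ} (h : t < T) : Polynomial.Sequence ℝ where
  elems' j := C (Real.sqrt ((2 * (j : ℝ) + 1) / (T - t))) *
    (rodrigues j).comp (C (2 / (T - t)) * X + C (-(t + (T - t) / 2) * (2 / (T - t))))
  degree_eq' j := by
    have hpos : 0 < T - t := sub_pos.mpr h
    have hs : Real.sqrt ((2 * (j : ℝ) + 1) / (T - t)) ≠ 0 := by positivity
    have h2 : 2 / (T - t) ≠ 0 := by positivity
    rw [degree_C_mul hs, degree_eq_iff_natDegree_eq, natDegree_comp, natDegree_linear h2, mul_one,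
      natDegree_eq_of_degree_eq_some (degree_rodrigues j)]
    rw [ne_eq, comp_eq_zero_iff, not_or, not_and_or]
    refine ⟨degree_ne_bot.mp (by simp [degree_rodrigues]), Or.inr fun hC => ?_⟩
    have := congrArg natDegree hC
    rw [natDegree_linear h2, natDegree_C] at this
    exact one_ne_zero this

theorem eval_shiftedLegendreSequence {t T : ℝ} (h : t < T) (j : ℕ) (x : ℝ) :
    (shiftedLegendreSequence h j).eval x = shiftedLegendre t T j x := by
  rw [shiftedLegendre, legendreP_eq_eval]
  change eval x (C _ * Polynomial.comp _ _) = _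
  simp only [eval_mul, eval_C, eval_comp, eval_add, eval_X]
  congr 2
  ring

theorem continuous_shiftedLegendre {t T : ℝ} (h : t < T) (j : ℕ) :
    Continuous (shiftedLegendre t T j) := by
  simpa only [eval_shiftedLegendreSequence h] using (shiftedLegendreSequence h j).continuous

theorem integral_shiftedLegendre_mul {t T : ℝ} (h : t < T) (i j : ℕ) :
    ∫ x in t..T, shiftedLegendre t T i x * shiftedLegendre t T j x = if i = j then 1 else 0 := by
  have hpos : 0 < T - t := sub_pos.mpr h
  have hcv := intervalIntegral.integral_comp_mul_add (a := t) (b := T)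
    (fun y => (rodrigues i).eval y * (rodrigues j).eval y)
    (c := 2 / (T - t)) (by positivity) (-(t + (T - t) / 2) * (2 / (T - t)))
  have ha : 2 / (T - t) * t + -(t + (T - t) / 2) * (2 / (T - t)) = -1 := by field_simp; ring
  have hb : 2 / (T - t) * T + -(t + (T - t) / 2) * (2 / (T - t)) = 1 := by field_simp; ring
  rw [ha, hb, integral_rodrigues_mul_rodrigues] at hcv
  have heq (x : ℝ) : shiftedLegendre t T i x * shiftedLegendre t T j x =
      (Real.sqrt ((2 * (i : ℝ) + 1) / (T - t)) * Real.sqrt ((2 * (j : ℝ) + 1) / (T - t))) *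
        ((rodrigues i).eval (2 / (T - t) * x + -(t + (T - t) / 2) * (2 / (T - t))) *
          (rodrigues j).eval (2 / (T - t) * x + -(t + (T - t) / 2) * (2 / (T - t)))) := by
    rw [shiftedLegendre, shiftedLegendre, legendreP_eq_eval, legendreP_eq_eval,
      show (x - t - (T - t) / 2) * (2 / (T - t)) =
        2 / (T - t) * x + -(t + (T - t) / 2) * (2 / (T - t)) by ring]
    ring
  simp_rw [heq]
  rw [intervalIntegral.integral_const_mul, hcv]
  split_ifs with hij
  · subst hij
    rw [Real.mul_self_sqrt (by positivity), smul_eq_mul]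
    field_simp
  · simp

section Parseval

attribute [local instance] Measure.Subtype.measureSpace

theorem isFiniteMeasure_volume_Icc (t T : ℝ) :
    IsFiniteMeasure (volume : Measure (Set.Icc t T)) where
  measure_univ_lt_top := by
    rw [Measure.Subtype.volume_univ measurableSet_Icc.nullMeasurableSet]
    exact measure_Icc_lt_top

attribute [local instance] isFiniteMeasure_volume_Icc


/-- A polynomial sequence which is orthonormal on `[t, T]` is a Hilbert basis of `L²([t, T])`. -/
theorem Polynomial.Sequence.exists_hilbertBasis {t T : ℝ} (h : t ≤ T) (S : Polynomial.Sequence ℝ)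
    (hS : ∀ i j, ∫ x in t..T, (S i).eval x * (S j).eval x = if i = j then 1 else 0) :
    ∃ b : HilbertBasis ℕ ℝ (Lp ℝ 2 (volume : Measure (Set.Icc t T))),
      ∀ j, b j = ContinuousMap.toLp 2 volume ℝ ((S j).toContinuousMapOn (Set.Icc t T)) := by
  let A : C(Set.Icc t T, ℝ) →L[ℝ] Lp ℝ 2 (volume : Measure (Set.Icc t T)) :=
    ContinuousMap.toLp 2 volume ℝ
  let v : ℕ → Lp ℝ 2 (volume : Measure (Set.Icc t T)) := fun j =>
    A ((S j).toContinuousMapOn (Set.Icc t T))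
  have hv : Orthonormal ℝ v := by
    rw [orthonormal_iff_ite]
    intro i j
    rw [← hS i j, intervalIntegral.integral_of_le h, ← integral_Icc_eq_integral_Ioc,
      ← integral_subtype measurableSet_Icc]
    refine (ContinuousMap.inner_toLp _ _ _).trans (integral_congr_ae (.of_forall fun x => ?_))
    simp [mul_comm]
  have hspan : Submodule.span ℝ (Set.range v) =
      (Subalgebra.toSubmodule (polynomialFunctions (Set.Icc t T))).map A.toLinearMap := by
    have hr : Set.range v = (A.toLinearMap ∘ₗ
        (Polynomial.toContinuousMapOnAlgHom (Set.Icc t T)).toLinearMap) '' Set.range S := by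
      rw [← Set.range_comp]
      rfl
    rw [hr, ← Submodule.map_span, S.span fun i => (leadingCoeff_ne_zero.mpr (S.ne_zero i)).isUnit,
      Submodule.map_comp]
    congr 1
  have hdense : (Submodule.span ℝ (Set.range v)).topologicalClosure = ⊤ := by
    rw [hspan]
    refine (ContinuousMap.toLp_denseRange ℝ (volume : Measure (Set.Icc t T)) ℝ
      (by simp)).topologicalClosure_map_submodule ?_
    exact congrArg Subalgebra.toSubmodule (polynomialFunctions_closure_eq_top t T)
  exact ⟨HilbertBasis.mk hv hdense.ge, fun j => by rw [HilbertBasis.coe_mk]⟩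

/-- Parseval's identity for an orthonormal polynomial sequence on `[t, T]`. -/
theorem Polynomial.Sequence.hasSum_integral_mul_integral {t T : ℝ} (h : t ≤ T)
    (S : Polynomial.Sequence ℝ)
    (hS : ∀ i j, ∫ x in t..T, (S i).eval x * (S j).eval x = if i = j then 1 else 0)
    {F G : ℝ → ℝ} (hF : MemLp (fun x : Set.Icc t T => F x) 2)
    (hG : MemLp (fun x : Set.Icc t T => G x) 2) :
    HasSum (fun j => (∫ x in t..T, F x * (S j).eval x) * ∫ x in t..T, G x * (S j).eval x)
      (∫ x in t..T, F x * G x) := by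
  obtain ⟨b, hb⟩ := S.exists_hilbertBasis h hS
  have hinner {H K : ℝ → ℝ} {f g : Lp ℝ 2 (volume : Measure (Set.Icc t T))}
      (hf : f =ᵐ[volume] fun x : Set.Icc t T => H x)
      (hg : g =ᵐ[volume] fun x : Set.Icc t T => K x) :
      inner ℝ f g = ∫ x in t..T, H x * K x := by
    rw [intervalIntegral.integral_of_le h, ← integral_Icc_eq_integral_Ioc,
      ← integral_subtype measurableSet_Icc, L2.inner_def]
    refine integral_congr_ae ?_
    filter_upwards [hf, hg] with x hx hy
    simp [hx, hy, mul_comm]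
  have hbj (j : ℕ) : b j =ᵐ[volume] fun x : Set.Icc t T => (S j).eval (x : ℝ) := by
    rw [hb]
    exact ContinuousMap.coeFn_toLp _ _
  have hsum := b.hasSum_inner_mul_inner (hF.toLp _) (hG.toLp _)
  rw [hinner hF.coeFn_toLp hG.coeFn_toLp] at hsum
  convert! hsum using 2 with j
  rw [real_inner_comm _ (b j), hinner (K := fun x => (S j).eval x) hF.coeFn_toLp (hbj j),
    hinner (K := fun x => (S j).eval x) hG.coeFn_toLp (hbj j)]

theorem memLp_Icc_of_continuous {t T : ℝ} {F : ℝ → ℝ} (hF : Continuous F) :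
    MemLp (fun x : Set.Icc t T => F x) 2 := by
  obtain ⟨C, hC⟩ := isCompact_Icc.exists_bound_of_continuousOn (s := Set.Icc t T) hF.continuousOn
  exact MemLp.of_bound (hF.comp continuous_subtype_val).aestronglyMeasurable C
    (.of_forall fun x => hC x x.2)

theorem memLp_Icc_indicator (t T y : ℝ) :
    MemLp (fun x : Set.Icc t T => (Set.Iic y).indicator (1 : ℝ → ℝ) x) 2 :=
  MemLp.of_bound ((measurable_one.indicator measurableSet_Iic).comp
    measurable_subtype_coe).aestronglyMeasurable 1
    (.of_forall fun x => by by_cases hx : (x : ℝ) ∈ Set.Iic y <;> simp [Set.indicator, hx])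

theorem intervalIntegral_indicator_Iic_mul {t T y : ℝ} (hy : y ∈ Set.Icc t T) (f : ℝ → ℝ) :
    ∫ x in t..T, (Set.Iic y).indicator (1 : ℝ → ℝ) x * f x = ∫ x in t..y, f x := by
  rw [← intervalIntegral.integral_indicator hy]
  refine intervalIntegral.integral_congr fun x _ => ?_
  by_cases hx : x ≤ y <;> simp [Set.indicator, hx]

/-- Parseval's identity for the indicator functions of `[t, y]` and `[t, z]`. -/
theorem Polynomial.Sequence.hasSum_integral_Iic_mul_integral_Iic {t T : ℝ} (h : t ≤ T)
    (S : Polynomial.Sequence ℝ)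
    (hS : ∀ i j, ∫ x in t..T, (S i).eval x * (S j).eval x = if i = j then 1 else 0)
    {y z : ℝ} (hy : y ∈ Set.Icc t T) (hz : z ∈ Set.Icc t T) (hyz : y ≤ z) :
    HasSum (fun j => (∫ x in t..y, (S j).eval x) * ∫ x in t..z, (S j).eval x) (y - t) := by
  have hsum := S.hasSum_integral_mul_integral h hS
    (memLp_Icc_indicator t T y) (memLp_Icc_indicator t T z)
  simp_rw [intervalIntegral_indicator_Iic_mul hy, intervalIntegral_indicator_Iic_mul hz] at hsum
  convert! hsum using 1
  rw [intervalIntegral.integral_congr (g := fun _ => (1 : ℝ)), intervalIntegral.integral_const,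
    smul_eq_mul, mul_one]
  intro x hx
  rw [Set.uIcc_of_le hy.1] at hx
  simp [Set.indicator, hx.2.trans hyz]

end Parseval

/-- Integration by parts reduces the triple integral with equal outer functions to a single one. -/
theorem integral_mul_integral_mul_integral {a b : ℝ → ℝ} (ha : Continuous a) (hb : Continuous b)
    (t T : ℝ) :
    ∫ z in t..T, a z * ∫ y in t..z, b y * ∫ x in t..y, a x =
      ∫ y in t..T, b y * ((∫ x in t..y, a x) * ((∫ x in t..T, a x) - ∫ x in t..y, a x)) := by
  have hA : Continuous fun y => ∫ x in t..y, a x :=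
    intervalIntegral.continuous_primitive (fun _ _ => ha.intervalIntegrable _ _) t
  have hbA : Continuous fun y => b y * ∫ x in t..y, a x := hb.mul hA
  have parts := intervalIntegral.integral_mul_deriv_eq_deriv_mul (a := t) (b := T)
    (u := fun z => ∫ y in t..z, b y * ∫ x in t..y, a x) (v := fun z => ∫ x in t..z, a x)
    (fun z _ => hbA.integral_hasStrictDerivAt t z |>.hasDerivAt)
    (fun z _ => ha.integral_hasStrictDerivAt t z |>.hasDerivAt)
    (hbA.intervalIntegrable _ _) (ha.intervalIntegrable _ _)
  simp_rw [mul_comm (a _)]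
  rw [parts, intervalIntegral.integral_same, zero_mul, sub_zero,
    ← intervalIntegral.integral_mul_const, ← intervalIntegral.integral_sub
      ((hbA.mul_const _).intervalIntegrable _ _) (hbA.fun_mul hA |>.intervalIntegrable _ _)]
  congr 1
  ext y
  ring

/-- The diagonal kernel `y ↦ ψ(y) (ψ(T) - ψ(y))`, where `ψ` is the primitive of the `j`-th shifted
Legendre function vanishing at `t`. -/
noncomputable def legendreKernel (t T : ℝ) (j : ℕ) (y : ℝ) : ℝ :=
  (∫ x in t..y, shiftedLegendre t T j x) *
    ((∫ x in t..T, shiftedLegendre t T j x) - ∫ x in t..y, shiftedLegendre t T j x)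

section Kernel

variable {t T : ℝ}

theorem continuous_legendreKernel (h : t < T) (j : ℕ) : Continuous (legendreKernel t T j) := by
  have hA : Continuous fun y => ∫ x in t..y, shiftedLegendre t T j x :=
    intervalIntegral.continuous_primitive
      (fun _ _ => (continuous_shiftedLegendre h j).intervalIntegrable _ _) t
  exact hA.mul (continuous_const.sub hA)

theorem tripleCoeff_diag_eq (h : t < T) (i j : ℕ) :
    tripleCoeff t T i j i = ∫ y in t..T, shiftedLegendre t T j y * legendreKernel t T i y :=
  integral_mul_integral_mul_integral (continuous_shiftedLegendre h i)
    (continuous_shiftedLegendre h j) t T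

theorem sum_tripleCoeff_diag_eq (h : t < T) (s : Finset ℕ) (j : ℕ) :
    ∑ i ∈ s, tripleCoeff t T i j i =
      ∫ y in t..T, (∑ i ∈ s, legendreKernel t T i y) * shiftedLegendre t T j y := by
  simp_rw [tripleCoeff_diag_eq h, Finset.sum_mul, mul_comm (shiftedLegendre _ _ _ _)]
  refine (intervalIntegral.integral_finsetSum fun i _ => ?_).symm
  exact ((continuous_legendreKernel h i).mul
    (continuous_shiftedLegendre h j)).intervalIntegrable _ _

theorem hasSum_primitive_shiftedLegendre (h : t < T) {y z : ℝ} (hy : y ∈ Set.Icc t T)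
    (hz : z ∈ Set.Icc t T) (hyz : y ≤ z) :
    HasSum (fun j => (∫ x in t..y, shiftedLegendre t T j x) * ∫ x in t..z, shiftedLegendre t T j x)
      (y - t) := by
  simpa only [eval_shiftedLegendreSequence h] using
    (shiftedLegendreSequence h).hasSum_integral_Iic_mul_integral_Iic h.le
      (by simpa only [eval_shiftedLegendreSequence h] using integral_shiftedLegendre_mul h)
      hy hz hyz

theorem hasSum_sq_integral_mul_shiftedLegendre (h : t < T) {g : ℝ → ℝ} (hg : Continuous g) :
    HasSum (fun j => (∫ x in t..T, g x * shiftedLegendre t T j x) ^ 2) (∫ x in t..T, g x ^ 2) := by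
  simpa only [eval_shiftedLegendreSequence h, sq] using
    (shiftedLegendreSequence h).hasSum_integral_mul_integral h.le
      (by simpa only [eval_shiftedLegendreSequence h] using integral_shiftedLegendre_mul h)
      (memLp_Icc_of_continuous hg) (memLp_Icc_of_continuous hg)

theorem hasSum_legendreKernel (h : t < T) {y : ℝ} (hy : y ∈ Set.Icc t T) :
    HasSum (fun j => legendreKernel t T j y) 0 := by
  have hsum := (hasSum_primitive_shiftedLegendre h hy (Set.right_mem_Icc.mpr h.le) hy.2).sub
    (hasSum_primitive_shiftedLegendre h hy hy le_rfl)
  simpa only [legendreKernel, mul_sub, sub_self] using hsum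

theorem sum_abs_legendreKernel_le (h : t < T) (s : Finset ℕ) {y : ℝ} (hy : y ∈ Set.Icc t T) :
    ∑ j ∈ s, |legendreKernel t T j y| ≤ 2 * (T - t) := by
  have hT : T ∈ Set.Icc t T := Set.right_mem_Icc.mpr h.le
  have hsum := ((hasSum_primitive_shiftedLegendre h hy hy le_rfl).mul_left (3 / 2)).add
    ((hasSum_primitive_shiftedLegendre h hT hT le_rfl).mul_left (1 / 2))
  calc ∑ j ∈ s, |legendreKernel t T j y|
      ≤ ∑ j ∈ s, (3 / 2 * ((∫ x in t..y, shiftedLegendre t T j x) *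
            ∫ x in t..y, shiftedLegendre t T j x) +
          1 / 2 * ((∫ x in t..T, shiftedLegendre t T j x) *
            ∫ x in t..T, shiftedLegendre t T j x)) := by
        refine Finset.sum_le_sum fun j _ => ?_
        rw [legendreKernel, abs_le]
        set a := ∫ x in t..y, shiftedLegendre t T j x
        set c := ∫ x in t..T, shiftedLegendre t T j x
        constructor <;> nlinarith [sq_nonneg (a + c), sq_nonneg (a - c), sq_nonneg a, sq_nonneg c]
    _ ≤ 3 / 2 * (y - t) + 1 / 2 * (T - t) :=
        sum_le_hasSum s (fun j _ => by
          have := mul_self_nonneg (∫ x in t..y, shiftedLegendre t T j x)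
          have := mul_self_nonneg (∫ x in t..T, shiftedLegendre t T j x)
          positivity) hsum
    _ ≤ 2 * (T - t) := by linarith [hy.2]

theorem tendsto_integral_sum_legendreKernel_sq (h : t < T) :
    Filter.Tendsto
      (fun q : ℕ => ∫ y in t..T, (∑ j ∈ Finset.range (q + 1), legendreKernel t T j y) ^ 2)
      Filter.atTop (nhds 0) := by
  have hlim := intervalIntegral.tendsto_integral_filter_of_dominated_convergence (μ := volume)
    (a := t) (b := T) (l := Filter.atTop) (f := fun _ => (0 : ℝ))
    (F := fun q : ℕ => fun y => (∑ j ∈ Finset.range (q + 1), legendreKernel t T j y) ^ 2)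
    (fun _ => (2 * (T - t)) ^ 2)
    (.of_forall fun q => ((continuous_finsetSum _ fun j _ =>
      continuous_legendreKernel h j).pow 2).aestronglyMeasurable)
    (.of_forall fun q => .of_forall fun y hy => ?_)
    intervalIntegrable_const
    (.of_forall fun y hy => ?_)
  · simpa using hlim
  · rw [Set.uIoc_of_le h.le] at hy
    rw [Real.norm_eq_abs, abs_pow]
    gcongr
    exact (Finset.abs_sum_le_sum_abs _ _).trans
      (sum_abs_legendreKernel_le h _ (Set.Ioc_subset_Icc_self hy))
  · rw [Set.uIoc_of_le h.le] at hy
    have := ((hasSum_legendreKernel h (Set.Ioc_subset_Icc_self hy)).tendsto_sum_nat.comp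
      (Filter.tendsto_add_atTop_nat 1)).pow 2
    simpa using this

theorem summable_tripleCoeff_diag (h : t < T) (j : ℕ) :
    Summable fun i => tripleCoeff t T i j i := by
  have hφ := continuous_shiftedLegendre h j
  have hK := continuous_legendreKernel h
  obtain ⟨M, hM⟩ := isCompact_Icc.exists_bound_of_continuousOn (s := Set.Icc t T) hφ.continuousOn
  have hM0 : 0 ≤ M := (norm_nonneg _).trans (hM t (Set.left_mem_Icc.mpr h.le))
  refine Summable.of_abs (summable_of_sum_range_le (c := ∫ _ in t..T, M * (2 * (T - t)))
    (fun _ => abs_nonneg _) fun n => ?_)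
  calc ∑ i ∈ Finset.range n, |tripleCoeff t T i j i|
      ≤ ∑ i ∈ Finset.range n, ∫ y in t..T, |shiftedLegendre t T j y * legendreKernel t T i y| := by
        gcongr with i
        rw [tripleCoeff_diag_eq h]
        exact intervalIntegral.abs_integral_le_integral_abs h.le
    _ = ∫ y in t..T, ∑ i ∈ Finset.range n, |shiftedLegendre t T j y * legendreKernel t T i y| :=
        (intervalIntegral.integral_finsetSum fun i _ =>
          (hφ.mul (hK i)).abs.intervalIntegrable _ _).symm
    _ ≤ ∫ _ in t..T, M * (2 * (T - t)) := by
        refine intervalIntegral.integral_mono_on h.le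
          ((continuous_finsetSum _ fun i _ => (hφ.mul (hK i)).abs).intervalIntegrable _ _)
          intervalIntegrable_const fun y hy => ?_
        simp_rw [abs_mul, ← Finset.mul_sum]
        exact mul_le_mul (hM y hy) (sum_abs_legendreKernel_le h _ hy)
          (Finset.sum_nonneg fun _ _ => abs_nonneg _) hM0

end Kernel

end

/-- `lim_{q→∞} Σ_{j₂=0}^∞ (Σ_{j₁=0}^{q} C_{j₁j₂j₁})² = 0`; in particular, for
every `j₂`, `Σ_{j₁=0}^∞ C_{j₁j₂j₁} = 0`. -/
theorem tripleCoeff_diag_outer_sum (t T : ℝ) (h : t < T) :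
    Filter.Tendsto
      (fun q : ℕ => ∑' j₂ : ℕ,
        (∑ j₁ ∈ Finset.range (q + 1), tripleCoeff t T j₁ j₂ j₁) ^ 2)
      Filter.atTop (nhds 0) ∧
    ∀ j₂ : ℕ, HasSum (fun j₁ : ℕ => tripleCoeff t T j₁ j₂ j₁) 0 := by
  have hparseval (q : ℕ) : HasSum
      (fun j₂ => (∑ j₁ ∈ Finset.range (q + 1), tripleCoeff t T j₁ j₂ j₁) ^ 2)
      (∫ y in t..T, (∑ j ∈ Finset.range (q + 1), legendreKernel t T j y) ^ 2) := by
    simp_rw [sum_tripleCoeff_diag_eq h]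
    exact hasSum_sq_integral_mul_shiftedLegendre h
      (continuous_finsetSum _ fun j _ => continuous_legendreKernel h j)
  have hlim := tendsto_integral_sum_legendreKernel_sq h
  refine ⟨by simpa only [(hparseval _).tsum_eq] using hlim, fun j₂ => ?_⟩
  rw [(summable_tripleCoeff_diag h j₂).hasSum_iff_tendsto_nat, ← Filter.tendsto_add_atTop_iff_nat 1]
  have hsq := squeeze_zero (fun q => sq_nonneg _)
    (fun q => le_hasSum (hparseval q) j₂ fun _ _ => sq_nonneg _) hlim
  rw [tendsto_zero_iff_abs_tendsto_zero]
  simpa [Function.comp_def, Real.sqrt_sq_eq_abs] using hsq.sqrt
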